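/- arXiv:1612.09057 — 2 statements merged into one kernel-verified Lean document; each statement's English description precedes it below -/
import Mathlib

section
/- Assume d·λ² < 1. Then there exist constants c > 0 and C > 0, depending only on d, q, k and λ (but not on h), such that for every depth h there exists a probability mass function Q_h on count vectors N : (Fin q)^k → ℕ with the property that for every root value x ∈ (Fin q)^k and every count vector s, P_{x,h}(s) ≥ (1 − C·exp(−c·h))·Q_h(s); equivalently, P_{x,h} = (1−η)·Q_h + η·P'_{x,h} for some probability mass function P'_{x,h} and some η ≤ C·exp(−c·h) independent of x. (Lemma on count reconstruction: exponentially small dependence of the leaf counts on the root.) -/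
/-- Vertices of the rooted `d`-ary tree of depth `h`: a vertex at level `l ≤ h` is a
path of `l` child-choices from the root. -/
abbrev Vtx (d h : ℕ) := Σ l : Fin (h + 1), Fin (l : ℕ) → Fin d

/-- Leaves of the rooted `d`-ary tree of depth `h`. -/
abbrev Leaf (d h : ℕ) := Fin h → Fin d

/-- Representations: strings of length `k` over the alphabet `Fin q`. -/
abbrev RepSpace (q k : ℕ) := Fin k → Fin q

/-- The root of the tree. -/
def root (d h : ℕ) : Vtx d h := ⟨⟨0, Nat.succ_pos h⟩, fun i => (i : Fin 0).elim0⟩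

/-- The parent of a vertex (the root is its own parent). -/
def parent {d h : ℕ} (v : Vtx d h) : Vtx d h :=
  ⟨⟨(v.1 : ℕ) - 1, by have := v.1.isLt; omega⟩,
    fun i => v.2 ⟨(i : ℕ), lt_of_lt_of_le i.isLt (Nat.sub_le _ _)⟩⟩

/-- The vertex corresponding to a leaf. -/
def leafVtx {d h : ℕ} (f : Leaf d h) : Vtx d h :=
  ⟨⟨h, Nat.lt_succ_self h⟩, fun i => f i⟩

/-- Graph distance between two leaves: twice the number of levels below their deepest
common ancestor. -/
def leafDist {d h : ℕ} (u v : Leaf d h) : ℕ :=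
  2 * (Finset.univ.filter fun i : Fin h => ∃ j : Fin h, j ≤ i ∧ u j ≠ v j).card

/-- One step of the `q`-ary symmetric channel with retention parameter `λ`:
the probability that the child letter is `a` given that the parent letter is `b`. -/
noncomputable def edgeFactor (q : ℕ) (lam : ℝ) (a b : Fin q) : ℝ :=
  lam * (if a = b then 1 else 0) + (1 - lam) / q

/-- The probability mass function of the IIDM (i.i.d. symmetric Markov model) on the
`d`-ary tree of depth `h` with alphabet `Fin q`, string length `k` and retention
parameter `λ`: the root string is uniform and each letter is independently retained
with probability `λ` along each edge and otherwise rerandomized uniformly. -/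
noncomputable def iidmPMF (d h q k : ℕ) (lam : ℝ) (R : Vtx d h → RepSpace q k) : ℝ :=
  (1 / (q : ℝ) ^ k) *
    ∏ v : Vtx d h,
      if (v.1 : ℕ) = 0 then 1
      else ∏ i : Fin k, edgeFactor q lam (R v i) (R (parent v) i)

open Classical in
/-- The probability of an event under the IIDM. -/
noncomputable def iidmProb (d h q k : ℕ) (lam : ℝ)
    (E : (Vtx d h → RepSpace q k) → Prop) : ℝ :=
  ∑ R ∈ Finset.univ.filter (fun R => E R), iidmPMF d h q k lam R

/-- The probability mass function of the broadcast process on the `d`-ary tree of depth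
`h` with root value pinned to `x ∈ (Fin q)^k`. -/
noncomputable def bcastPMF (d h q k : ℕ) (lam : ℝ) (x : RepSpace q k)
    (R : Vtx d h → RepSpace q k) : ℝ :=
  (if R (root d h) = x then 1 else 0) *
    ∏ v : Vtx d h,
      if (v.1 : ℕ) = 0 then 1
      else ∏ i : Fin k, edgeFactor q lam (R v i) (R (parent v) i)

open Classical in
/-- The count statistic of a configuration: for each `y ∈ (Fin q)^k`, the number of
leaves whose representation is `y`. -/
noncomputable def countStat (d h q k : ℕ) (R : Vtx d h → RepSpace q k) :
    RepSpace q k → ℕ :=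
  fun y => (Finset.univ.filter fun f : Leaf d h => R (leafVtx f) = y).card

open Classical in
/-- `P_{x,h}(s)`: the probability that the count statistic of the broadcast with root
value `x` on the depth-`h` tree equals `s`. -/
noncomputable def countDist (d h q k : ℕ) (lam : ℝ) (x : RepSpace q k)
    (s : RepSpace q k → ℕ) : ℝ :=
  ∑ R ∈ Finset.univ.filter (fun R => countStat d h q k R = s),
    bcastPMF d h q k lam x R


namespace CR
open MvPolynomial

section nrm
variable {ι : Type*}

noncomputable def nrm (p : MvPolynomial ι ℝ) : ℝ := ∑ m ∈ p.support, |coeff m p|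

lemma nrm_eq (p : MvPolynomial ι ℝ) (S : Finset (ι →₀ ℕ)) (h : p.support ⊆ S) :
    nrm p = ∑ m ∈ S, |coeff m p| := by
  unfold nrm
  refine Finset.sum_subset h ?_
  intro m _ hm
  rw [notMem_support_iff.mp hm, abs_zero]

lemma le_nrm (p : MvPolynomial ι ℝ) (S : Finset (ι →₀ ℕ)) :
    ∑ m ∈ S, |coeff m p| ≤ nrm p := by
  classical
  rw [nrm_eq p (p.support ∪ S) Finset.subset_union_left]
  exact Finset.sum_le_sum_of_subset_of_nonneg Finset.subset_union_right
    (fun _ _ _ => abs_nonneg _)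

lemma nrm_nonneg (p : MvPolynomial ι ℝ) : 0 ≤ nrm p :=
  Finset.sum_nonneg (fun _ _ => abs_nonneg _)

lemma nrm_zero : nrm (0 : MvPolynomial ι ℝ) = 0 := by simp [nrm]

lemma nrm_add (p r : MvPolynomial ι ℝ) : nrm (p + r) ≤ nrm p + nrm r := by
  classical
  rw [nrm_eq p (p.support ∪ r.support) Finset.subset_union_left,
    nrm_eq r (p.support ∪ r.support) Finset.subset_union_right,
    nrm_eq (p + r) (p.support ∪ r.support) support_add, ← Finset.sum_add_distrib]
  refine Finset.sum_le_sum fun m _ => ?_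
  rw [coeff_add]; exact abs_add_le _ _

lemma nrm_sum {α : Type*} (s : Finset α) (f : α → MvPolynomial ι ℝ) :
    nrm (∑ i ∈ s, f i) ≤ ∑ i ∈ s, nrm (f i) :=
  Finset.le_sum_of_subadditive nrm nrm_zero.le nrm_add s f

lemma nrm_monomial (m : ι →₀ ℕ) (c : ℝ) : nrm (monomial m c) ≤ |c| := by
  classical
  rw [nrm_eq _ {m} support_monomial_subset]
  simp

lemma nrm_mul (p r : MvPolynomial ι ℝ) : nrm (p * r) ≤ nrm p * nrm r := by
  have h : p * r = ∑ m ∈ p.support, ∑ n ∈ r.support,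
      monomial (m + n) (coeff m p * coeff n r) := by
    conv_lhs => rw [p.as_sum, r.as_sum]
    rw [Finset.sum_mul_sum]
    simp only [monomial_mul]
  rw [h]
  refine (nrm_sum _ _).trans ?_
  unfold nrm
  rw [Finset.sum_mul_sum]
  refine Finset.sum_le_sum fun m _ => (nrm_sum _ _).trans ?_
  refine Finset.sum_le_sum fun n _ => (nrm_monomial _ _).trans ?_
  rw [abs_mul]

lemma nrm_smul (c : ℝ) (p : MvPolynomial ι ℝ) : nrm (c • p) ≤ |c| * nrm p := by
  rw [smul_eq_C_mul]
  refine (nrm_mul _ _).trans ?_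
  exact mul_le_mul_of_nonneg_right (nrm_monomial 0 c) (nrm_nonneg _)

lemma nrm_X_le (a : ι) : nrm (X a : MvPolynomial ι ℝ) ≤ 1 := by
  have h := nrm_monomial (Finsupp.single a 1) (1:ℝ)
  rw [abs_one] at h
  exact h

end nrm

section binom

lemma binom_ident {A : Type*} [CommRing A] (x y : A) (n : ℕ) :
    ∑ i ∈ Finset.range (n + 2), ((n+1).choose i : A) * i * (x ^ i * y ^ (n + 1 - i))
      = (n + 1) * (x * (x + y) ^ n) := by
  rw [Finset.sum_range_succ', add_pow]
  simp only [Nat.cast_zero, mul_zero, zero_mul, add_zero]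
  rw [Finset.mul_sum, Finset.mul_sum]
  refine Finset.sum_congr rfl fun i _ => ?_
  have h : (((n+1).choose (i+1) : A)) * ((i + 1 : ℕ) : A) = (n + 1) * (n.choose i : A) := by
    have := Nat.add_one_mul_choose_eq n i
    have h2 := congrArg (Nat.cast : ℕ → A) this
    push_cast at h2 ⊢
    rw [← h2]
  rw [h, Nat.add_sub_add_right]
  ring

lemma binom_ident2 {A : Type*} [CommRing A] (x y : A) (n : ℕ) :
    ∑ i ∈ Finset.range (n + 2), ((n+1).choose i : A) * (2 * i - (n + 1)) * (x ^ i * y ^ (n + 1 - i))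
      = (n + 1) * ((x + y) ^ n * (x - y)) := by
  have h1 := binom_ident x y n
  have h2 := add_pow x y (n+1)
  have : ∀ i ∈ Finset.range (n+2), ((n+1).choose i : A) * (2 * i - (n + 1)) * (x ^ i * y ^ (n + 1 - i))
     = 2 * (((n+1).choose i : A) * i * (x ^ i * y ^ (n + 1 - i)))
       - (n+1) * (x ^ i * y ^ (n + 1 - i) * ((n+1).choose i : A)) := by
    intro i _; ring
  rw [Finset.sum_congr rfl this, Finset.sum_sub_distrib, ← Finset.mul_sum, ← Finset.mul_sum, h1, ← h2]
  ring

lemma binom_var (n : ℕ) :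
    ∑ i ∈ Finset.range (n + 1), (n.choose i : ℝ) * (2 * (i:ℝ) - n) ^ 2 = (n:ℝ) * 2 ^ n := by
  have h := congrArg (Polynomial.eval (1/2 : ℝ)) (bernsteinPolynomial.variance ℝ n)
  simp only [Polynomial.eval_finsetSum, bernsteinPolynomial, Polynomial.eval_mul,
    Polynomial.eval_pow, Polynomial.eval_sub, Polynomial.eval_X,
    Polynomial.eval_natCast, Polynomial.eval_one, nsmul_eq_mul] at h
  have h2 : ∀ i ∈ Finset.range (n+1), (n.choose i : ℝ) * (2 * (i:ℝ) - n) ^ 2 =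
      4 * 2 ^ n * ((n * (1/2 : ℝ) - i) ^ 2 * (n.choose i * (1/2) ^ i * (1 - 1/2) ^ (n - i))) := by
    intro i hi
    have hi' : i ≤ n := by simpa [Nat.lt_succ_iff] using hi
    have : (1/2:ℝ) ^ i * (1 - 1/2) ^ (n - i) * 2 ^ n = 1 := by
      rw [show (1 - 1/2 : ℝ) = 1/2 by norm_num, ← pow_add, Nat.add_sub_cancel' hi', ← mul_pow]
      norm_num
    calc _ = (n.choose i : ℝ) * (2 * (i:ℝ) - n) ^ 2 * ((1/2:ℝ) ^ i * (1 - 1/2) ^ (n - i) * 2 ^ n) := by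
          rw [this, mul_one]
      _ = _ := by ring
  rw [Finset.sum_congr rfl h2, ← Finset.mul_sum, h]
  ring

lemma binom_abs (n : ℕ) :
    ∑ i ∈ Finset.range (n + 1), (n.choose i : ℝ) * |2 * (i:ℝ) - n| ≤ √n * 2 ^ n := by
  have h1 : ∑ i ∈ Finset.range (n + 1), (n.choose i : ℝ) = 2 ^ n := by
    exact_mod_cast Nat.sum_range_choose n
  have h := Finset.sum_mul_sq_le_sq_mul_sq (Finset.range (n+1))
    (fun i => √(n.choose i : ℝ)) (fun i => √(n.choose i : ℝ) * |2 * (i:ℝ) - n|)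
  simp only [← mul_assoc, mul_pow, sq_abs] at h
  simp only [Nat.cast_nonneg, Real.sq_sqrt, Real.mul_self_sqrt, h1, binom_var] at h
  refine abs_le_of_sq_le_sq' ?_ (by positivity) |>.2
  refine h.trans (le_of_eq ?_)
  rw [mul_pow, Real.sq_sqrt (Nat.cast_nonneg n)]
  ring

variable {ι : Type*}

lemma nrm_binom (a b : ι) (n : ℕ) :
    nrm (((1/2 : ℝ) • (X a + X b : MvPolynomial ι ℝ)) ^ n * (X a - X b)) ≤ 2 / √(n + 1) := by
  have h := binom_ident2 (X a : MvPolynomial ι ℝ) (X b) n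
  have e : ((1/2 : ℝ) • (X a + X b : MvPolynomial ι ℝ)) ^ n * (X a - X b)
      = ∑ i ∈ Finset.range (n + 2), ((1/2:ℝ)^n / (n+1) * (((n+1).choose i : ℝ) * (2 * i - (n + 1)))) •
         ((X a : MvPolynomial ι ℝ) ^ i * X b ^ (n + 1 - i)) := by
    have : ∀ i ∈ Finset.range (n+2), ((1/2:ℝ)^n / (n+1) * (((n+1).choose i : ℝ) * (2 * i - (n + 1)))) •
         ((X a : MvPolynomial ι ℝ) ^ i * X b ^ (n + 1 - i)) = ((1/2:ℝ)^n / (n+1)) •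
         (((n+1).choose i : MvPolynomial ι ℝ) * (2 * (i : MvPolynomial ι ℝ) - ((n : MvPolynomial ι ℝ) + 1)) * ((X a : MvPolynomial ι ℝ) ^ i * X b ^ (n + 1 - i))) := by
      intro i _
      rw [mul_smul]
      congr 1
      rw [smul_eq_C_mul]
      have h2 : (C (2:ℝ) : MvPolynomial ι ℝ) = 2 := map_ofNat C 2
      simp [h2]
    rw [Finset.sum_congr rfl this, ← Finset.smul_sum, h, smul_pow, smul_mul_assoc, div_eq_mul_inv ((1/2:ℝ)^n) ((n:ℝ)+1), mul_smul]
    congr 1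
    have hc : ((n:MvPolynomial ι ℝ) + 1) = C ((n:ℝ)+1) := by simp
    rw [hc, smul_eq_C_mul, ← mul_assoc, ← C_mul, inv_mul_cancel₀ (by positivity), C_1, one_mul]
  rw [e]
  have hm : ∀ i, nrm ((X a : MvPolynomial ι ℝ) ^ i * X b ^ (n + 1 - i)) ≤ 1 := by
    intro i
    rw [X_pow_eq_monomial, X_pow_eq_monomial, monomial_mul]
    simpa using nrm_monomial (Finsupp.single a i + Finsupp.single b (n+1-i)) (1*1:ℝ)
  calc _ ≤ ∑ i ∈ Finset.range (n + 2), (1/2:ℝ)^n / (n+1) * (((n+1).choose i : ℝ) * |2 * (i:ℝ) - ((n + 1 : ℕ):ℝ)|) := by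
        refine (nrm_sum _ _).trans (Finset.sum_le_sum fun i _ => (nrm_smul _ _).trans ?_)
        refine (mul_le_of_le_one_right (abs_nonneg _) (hm i)).trans (le_of_eq ?_)
        rw [abs_mul, abs_mul, abs_of_nonneg (by positivity : (0:ℝ) ≤ (1/2:ℝ)^n / (n+1)), Nat.abs_cast]
        push_cast
        rfl
    _ ≤ (1/2:ℝ)^n / (n+1) * (√((n+1:ℕ):ℝ) * 2 ^ (n+1)) := by
        rw [← Finset.mul_sum]
        exact mul_le_mul_of_nonneg_left (binom_abs (n+1)) (by positivity)
    _ = _ := by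
        have hs : √((n:ℝ)+1) ^ 2 = n + 1 := Real.sq_sqrt (by positivity)
        have hp : 0 < √((n:ℝ)+1) := by positivity
        push_cast
        rw [one_div, inv_pow, pow_succ]
        field_simp
        rw [hs]

lemma phi_ineq (t β : ℝ) (ht : 1 ≤ t) (h0 : 0 ≤ β) (h1 : β ≤ 1) :
    β * (1 / √(t + 1)) + (1 - β) * (1 / √t) ≤ 1 / √(t + β / 4) := by
  have hs : 0 < √t := by positivity
  have hss : √t ^ 2 = t := Real.sq_sqrt (by linarith)
  have hA : 1 / √(t+1) ≤ (1 - 1 / (4 * t)) * (1 / √t) := by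
    have hpos : 0 ≤ 1 - 1 / (4 * t) := by
      rw [sub_nonneg, div_le_one (by linarith)]; linarith
    have : √t ≤ (1 - 1 / (4 * t)) * √(t+1) := by
      refine abs_le_of_sq_le_sq' ?_ (by positivity) |>.2
      rw [mul_pow, Real.sq_sqrt (by linarith : 0 ≤ t + 1), hss]
      have : (1 - 1 / (4 * t)) ^ 2 * (t+1) - t = (8 * t^2 - 7 * t + 1) / (16 * t ^ 2) := by
        field_simp; ring
      have h2 : 0 ≤ (8 * t^2 - 7 * t + 1) / (16 * t ^ 2) := by
        apply div_nonneg <;> nlinarith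
      linarith
    rw [mul_one_div, div_le_div_iff₀ (by positivity) hs]
    linarith
  have hB : (1 - β / (4 * t)) * (1 / √t) ≤ 1 / √(t + β / 4) := by
    have hpos : 0 ≤ 1 - β / (4 * t) := by
      rw [sub_nonneg, div_le_one (by linarith)]; linarith
    rw [mul_one_div, div_le_div_iff₀ hs (by positivity)]
    rw [one_mul]
    refine abs_le_of_sq_le_sq' ?_ (by positivity) |>.2
    rw [mul_pow, Real.sq_sqrt (by positivity), hss]
    have : t - (1 - β / (4 * t)) ^ 2 * (t+β/4) = (β/4) * (1 + β/(4*t) - (β/(4*t))^2) := by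
        field_simp; ring
    have h3 : β / (4 * t) ≤ 1 := by rw [div_le_one (by linarith)]; linarith
    have h4 : 0 ≤ β / (4 * t) := by positivity
    have h5 : 0 ≤ (β/4) * (1 + β/(4*t) - (β/(4*t))^2) := by
      apply mul_nonneg (by positivity); nlinarith
    linarith
  calc _ ≤ β * ((1 - 1 / (4 * t)) * (1 / √t)) + (1 - β) * (1 / √t) := by gcongr
    _ = (1 - β / (4 * t)) * (1 / √t) := by ring
    _ ≤ _ := hB
end binom

section smoothing
variable {ι : Type*} [Fintype ι]

/-- averaged variable -/
noncomputable def av (M : ι → ι → ℝ) (W : ι → MvPolynomial ι ℝ) (x : ι) : MvPolynomial ι ℝ :=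
  ∑ y, M x y • W y

lemma smooth_aux (M : ι → ι → ℝ) (ε : ℝ) (hε : 0 ≤ ε) (hM : ∀ x y, ε ≤ M x y)
    (hM1 : ∀ x, ∑ y, M x y = 1) (a b : ι) (hab : a ≠ b) (l : List ι) :
    ∀ j : ℕ, nrm ((l.map (av M X)).prod * (((1/2 : ℝ) • (X a + X b)) ^ j * (X a - X b)))
      ≤ 2 / √(j + ε / 2 * l.length + 1) := by
  classical
  have hM0 : ∀ x y, 0 ≤ M x y := fun x y => hε.trans (hM x y)
  have hβ1 : 2 * ε ≤ 1 := by
    rw [← hM1 a]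
    calc 2 * ε = ε + ε := by ring
      _ ≤ M a a + M a b := add_le_add (hM _ _) (hM _ _)
      _ = ∑ y ∈ {a, b}, M a y := by rw [Finset.sum_pair hab]
      _ ≤ _ := Finset.sum_le_sum_of_subset_of_nonneg (Finset.subset_univ _) (fun _ _ _ => hM0 _ _)
  induction l with
  | nil =>
    intro j
    simpa using nrm_binom a b j
  | cons z l ih =>
    intro j
    set u : MvPolynomial ι ℝ := (1/2 : ℝ) • (X a + X b) with hu
    set L := (l.map (av M X)).prod with hL
    set G : MvPolynomial ι ℝ := ∑ y, (M z y - (if y = a then ε else 0) - (if y = b then ε else 0)) • X y with hG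
    have hdec : av M X z = (2 * ε) • u + G := by
      simp only [hG, av, sub_smul, Finset.sum_sub_distrib, ite_smul, zero_smul, Finset.sum_ite_eq', Finset.mem_univ, if_true, hu, smul_smul, smul_add]
      rw [show 2 * ε * (1/2) = ε by ring]
      abel
    have hGn : nrm G ≤ 1 - 2 * ε := by
      refine (nrm_sum _ _).trans ?_
      calc _ ≤ ∑ y, (M z y - (if y = a then ε else 0) - (if y = b then ε else 0)) := by
            refine Finset.sum_le_sum fun y _ => (nrm_smul _ _).trans ?_
            refine (mul_le_of_le_one_right (abs_nonneg _) (nrm_X_le y)).trans (le_of_eq ?_)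
            apply abs_of_nonneg
            have h1 := hM z y
            split_ifs with h2 h3
            · exact absurd (h2.symm.trans h3) hab
            · linarith
            · linarith
            · linarith
        _ = _ := by
            simp only [Finset.sum_sub_distrib, Finset.sum_ite_eq', Finset.mem_univ, if_true, hM1]
            ring
    have e : ((z :: l).map (av M X)).prod * (u ^ j * (X a - X b))
        = (2 * ε) • (L * (u ^ (j+1) * (X a - X b))) + G * (L * (u ^ j * (X a - X b))) := by
      rw [List.map_cons, List.prod_cons, hdec, smul_eq_C_mul, smul_eq_C_mul]
      ring
    rw [e]
    refine (nrm_add _ _).trans ?_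
    have i1 := ih (j+1)
    have i0 := ih j
    set t : ℝ := j + ε / 2 * l.length + 1 with ht
    have ht1 : 1 ≤ t := by
      have : 0 ≤ (j:ℝ) + ε / 2 * l.length := by positivity
      linarith
    have hphi := phi_ineq t (2*ε) ht1 (by positivity) hβ1
    have e1 : ((j+1:ℕ):ℝ) + ε / 2 * l.length + 1 = t + 1 := by rw [ht]; push_cast; ring
    have e2 : (j:ℝ) + ε / 2 * ((z :: l).length : ℕ) + 1 = t + (2 * ε) / 4 := by
      rw [ht, List.length_cons]; push_cast; ring
    rw [e1] at i1
    rw [e2]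
    calc _ ≤ (2 * ε) * (2 / √(t+1)) + (1 - 2 * ε) * (2 / √t) := by
          refine add_le_add ((nrm_smul _ _).trans ?_) ((nrm_mul _ _).trans ?_)
          · rw [abs_of_nonneg (by positivity)]
            gcongr
          · exact mul_le_mul hGn i0 (nrm_nonneg _) (by linarith)
      _ = 2 * (2 * ε * (1 / √(t + 1)) + (1 - 2 * ε) * (1 / √t)) := by ring
      _ ≤ 2 * (1 / √(t + 2 * ε / 4)) := by gcongr
      _ = _ := by ring

/-- uniform bound over products -/
def DB (M : ι → ι → ℝ) (n : ℕ) (p : MvPolynomial ι ℝ) (B : ℝ) : Prop :=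
  ∀ l : List ι, l.length = n → nrm ((l.map (av M X)).prod * p) ≤ B

def HB (M : ι → ι → ℝ) (m : ℕ) (c : MvPolynomial ι ℝ) : Prop :=
  ∀ n p B, DB M (m + n) p B → DB M n (c * p) B

variable (M : ι → ι → ℝ)

lemma DB_sum {α : Type*} (s : Finset α) (n : ℕ) (p : α → MvPolynomial ι ℝ) (B : α → ℝ)
    (h : ∀ i ∈ s, DB M n (p i) (B i)) : DB M n (∑ i ∈ s, p i) (∑ i ∈ s, B i) := by
  intro l hl
  rw [Finset.mul_sum]
  exact (nrm_sum _ _).trans (Finset.sum_le_sum fun i hi => h i hi l hl)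

lemma DB_smul (n : ℕ) (p : MvPolynomial ι ℝ) (B c : ℝ) (hc : 0 ≤ c)
    (h : DB M n p B) : DB M n (c • p) (c * B) := by
  intro l hl
  rw [mul_smul_comm]
  refine (nrm_smul _ _).trans ?_
  rw [abs_of_nonneg hc]
  exact mul_le_mul_of_nonneg_left (h l hl) hc

lemma HB_one : HB M 0 1 := by
  intro n p B h
  simpa using h

lemma HB_mul {m n : ℕ} {c e : MvPolynomial ι ℝ} (h1 : HB M m c) (h2 : HB M n e) :
    HB M (m + n) (c * e) := by
  intro r p B h
  rw [mul_assoc]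
  apply h1
  apply h2
  rwa [show n + (m + r) = m + n + r by ring]

lemma HB_pow {m : ℕ} {c : MvPolynomial ι ℝ} (h1 : HB M m c) (n : ℕ) :
    HB M (n * m) (c ^ n) := by
  induction n with
  | zero => simpa using HB_one M
  | succ n ih =>
    rw [pow_succ, Nat.succ_mul]
    exact HB_mul M ih h1

lemma HB_av (hM0 : ∀ x y, 0 ≤ M x y) (hM1 : ∀ x, ∑ y, M x y = 1) {m : ℕ}
    {W : ι → MvPolynomial ι ℝ} (h : ∀ y, HB M m (W y)) (x : ι) : HB M m (av M W x) := by
  intro n p B hB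
  unfold av
  rw [Finset.sum_mul]
  have := DB_sum M Finset.univ n (fun y => M x y • W y * p) (fun y => M x y * B) (by
    intro y _
    simp only [smul_mul_assoc]
    exact DB_smul M n _ _ _ (hM0 x y) (h y n p B hB))
  have e : ∑ y, M x y * B = B := by rw [← Finset.sum_mul, hM1, one_mul]
  rwa [e] at this

lemma HB_base (x : ι) : HB M 1 (av M X x) := by
  intro n p B h l hl
  have := h (x :: l) (by simp [hl]; ring)
  rw [List.map_cons, List.prod_cons] at this
  rwa [mul_left_comm, ← mul_assoc]

noncomputable def FF (d : ℕ) (W : ι → MvPolynomial ι ℝ) : ι → MvPolynomial ι ℝ :=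
  fun x => av M W x ^ d

lemma HB_iter (d : ℕ) (hM0 : ∀ x y, 0 ≤ M x y) (hM1 : ∀ x, ∑ y, M x y = 1) (h : ℕ) :
    ∀ x, HB M (d ^ h) (av M ((FF M d)^[h] X) x) := by
  induction h with
  | zero => intro x; simpa using HB_base M x
  | succ h ih =>
    intro x
    apply HB_av M hM0 hM1
    intro y
    rw [Function.iterate_succ_apply', pow_succ']
    exact HB_pow M (ih y) d

/-- Contraction along an abstract relation. -/
lemma contract (d : ℕ) (hd : 1 ≤ d) (lam ε : ℝ) (hlam : 0 ≤ lam) (hε : 0 ≤ ε)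
    (hM : ∀ x y, ε ≤ M x y) (hM1 : ∀ x, ∑ y, M x y = 1)
    (rel : ι → ι → Prop)
    (hrel : ∀ x y, rel x y → ∃ (u v : ι → ι), (∀ z, rel (u z) (v z)) ∧
      ∀ W : ι → MvPolynomial ι ℝ, av M W x - av M W y = lam • ∑ z, M x z • (W (u z) - W (v z))) (h : ℕ) :
    ∀ n x y, rel x y → DB M n ((FF M d)^[h] X x - (FF M d)^[h] X y)
      ((d * lam) ^ h * (2 / √(ε / 2 * ((n + d ^ h - 1 : ℕ) : ℝ) + 1))) := by
  have hM0 : ∀ x y, 0 ≤ M x y := fun x y => hε.trans (hM x y)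
  induction h with
  | zero =>
    intro n x y _ l hl
    by_cases hxy : x = y
    · subst hxy
      simp only [sub_self, mul_zero, nrm_zero]
      positivity
    · have := smooth_aux M ε hε hM hM1 x y hxy l 0
      simp [hl] at this ⊢
      exact this
  | succ h ih =>
    intro n x y hxy
    obtain ⟨u, v, huv, hW⟩ := hrel x y hxy
    rw [Function.iterate_succ_apply']
    set P := (FF M d)^[h] X with hP
    set B : ℝ := (d * lam) ^ h * (2 / √(ε / 2 * ((n + d ^ (h+1) - 1 : ℕ) : ℝ) + 1)) with hB
    have hdiff : DB M ((d-1) * d ^ h + n) (av M P x - av M P y) (lam * B) := by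
      rw [hW]
      apply DB_smul M _ _ _ _ hlam
      have := DB_sum M Finset.univ ((d-1) * d ^ h + n) (fun z => M x z • (P (u z) - P (v z)))
        (fun z => M x z * B) (by
          intro z _
          apply DB_smul M _ _ _ _ (hM0 _ _)
          have h1 := ih ((d-1) * d ^ h + n) (u z) (v z) (huv z)
          have e : (d-1) * d ^ h + n + d ^ h - 1 = n + d ^ (h+1) - 1 := by
            obtain ⟨d', rfl⟩ : ∃ d', d = d' + 1 := ⟨d - 1, by omega⟩
            congr 1
            simp only [Nat.add_sub_cancel]
            ring
          rw [e] at h1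
          exact h1)
      rwa [← Finset.sum_mul, hM1, one_mul] at this
    have hfac : FF M d P x - FF M d P y =
        ∑ i ∈ Finset.range d, (av M P x ^ i * av M P y ^ (d - 1 - i)) * (av M P x - av M P y) := by
      rw [← Finset.sum_mul, geom_sum₂_mul]
      rfl
    rw [hfac]
    have := DB_sum M (Finset.range d) n
      (fun i => (av M P x ^ i * av M P y ^ (d - 1 - i)) * (av M P x - av M P y))
      (fun _ => lam * B) (by
        intro i hi
        have hi' : i < d := by simpa using hi
        have hH := HB_mul M (HB_pow M (HB_iter M d hM0 hM1 h x) i)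
          (HB_pow M (HB_iter M d hM0 hM1 h y) (d - 1 - i))
        rw [← Nat.add_mul, Nat.add_sub_cancel' (by omega)] at hH
        exact hH n _ _ hdiff)
    rw [Finset.sum_const, Finset.card_range, nsmul_eq_mul] at this
    rw [pow_succ]
    convert this using 1
    rw [hB]; ring

lemma contract' (d : ℕ) (hd : 1 ≤ d) (lam ε : ℝ) (hlam : 0 ≤ lam) (hε : 0 < ε) (hε1 : ε ≤ 1)
    (hM : ∀ x y, ε ≤ M x y) (hM1 : ∀ x, ∑ y, M x y = 1)
    (rel : ι → ι → Prop)
    (hrel : ∀ x y, rel x y → ∃ (u v : ι → ι), (∀ z, rel (u z) (v z)) ∧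
      ∀ W : ι → MvPolynomial ι ℝ, av M W x - av M W y = lam • ∑ z, M x z • (W (u z) - W (v z))) (h : ℕ)
    (x y : ι) (hxy : rel x y) :
    nrm ((FF M d)^[h] X x - (FF M d)^[h] X y) ≤ (2 / √(ε / 2)) * (√d * lam) ^ h := by
  have := contract M d hd lam ε hlam hε.le hM hM1 rel hrel h 0 x y hxy [] rfl
  simp only [List.map_nil, List.prod_nil, one_mul, zero_add] at this
  refine this.trans ?_
  have hd0 : (0:ℝ) < d := by exact_mod_cast hd
  have h1 : ((d ^ h - 1 : ℕ) : ℝ) = (d:ℝ) ^ h - 1 := by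
    rw [Nat.cast_sub (Nat.one_le_pow _ _ hd)]; simp
  have h2 : √(ε / 2) * √d ^ h ≤ √(ε / 2 * ((d ^ h - 1 : ℕ) : ℝ) + 1) := by
    rw [h1]
    apply Real.le_sqrt_of_sq_le
    rw [mul_pow, Real.sq_sqrt (by positivity), ← pow_mul, mul_comm h 2, pow_mul, Real.sq_sqrt hd0.le]
    linarith
  have hsd : 0 < √(d:ℝ) := by positivity
  have hse : 0 < √(ε / 2) := by positivity
  calc _ ≤ (d * lam) ^ h * (2 / (√(ε / 2) * √d ^ h)) := by gcongr
    _ = _ := by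
      have : (d:ℝ) ^ h = √d ^ h * √d ^ h := by
        rw [← mul_pow, Real.mul_self_sqrt hd0.le]
      rw [mul_pow, mul_pow, this]
      field_simp
end smoothing

section tree
variable {d q k : ℕ}

noncomputable def ker (q k : ℕ) (lam : ℝ) (x y : RepSpace q k) : ℝ :=
  ∏ i : Fin k, edgeFactor q lam (y i) (x i)

def emb {d h : ℕ} (v : Vtx d h) : Vtx d (h + 1) := ⟨v.1.castSucc, v.2⟩

lemma parent_emb {h : ℕ} (v : Vtx d h) : parent (emb v) = emb (parent v) := rfl

lemma parent_leaf {h : ℕ} (f : Leaf d (h+1)) :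
    parent (leafVtx f) = emb (leafVtx (fun i : Fin h => f i.castSucc)) := rfl

lemma split_bij (d h : ℕ) :
    Function.Bijective (Sum.elim emb leafVtx : Vtx d h ⊕ Leaf d (h+1) → Vtx d (h+1)) := by
  constructor
  · have hne : ∀ (v : Vtx d h) (f : Leaf d (h+1)), emb v ≠ leafVtx f := by
      intro v f hvf
      have h1 : ((emb v).1 : ℕ) = ((leafVtx f).1 : ℕ) := by rw [hvf]
      have h2 : (v.1 : ℕ) = h + 1 := h1
      have := v.1.isLt
      omega
    rintro (v | f) (w | g) hvw
    · obtain ⟨l, v⟩ := v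
      obtain ⟨l', w⟩ := w
      simp only [Sum.elim_inl, emb, Sigma.mk.injEq] at hvw
      obtain ⟨h1, h2⟩ := hvw
      have h1 := Fin.castSucc_injective _ h1
      subst h1
      rw [eq_of_heq h2]
    · exact absurd hvw (hne v g)
    · exact absurd hvw.symm (hne w f)
    · simp only [Sum.elim_inr, leafVtx, Sigma.mk.injEq, true_and] at hvw
      rw [show f = g from eq_of_heq hvw]
  · rintro ⟨l, v⟩
    induction l using Fin.lastCases with
    | last => exact ⟨Sum.inr v, rfl⟩
    | cast l => exact ⟨Sum.inl ⟨l, v⟩, rfl⟩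

noncomputable def splitE (d h : ℕ) : Vtx d h ⊕ Leaf d (h+1) ≃ Vtx d (h+1) :=
  Equiv.ofBijective _ (split_bij d h)

noncomputable def cfgE (d h : ℕ) (α : Type*) :
    (Vtx d h → α) × (Leaf d (h+1) → α) ≃ (Vtx d (h+1) → α) :=
  (Equiv.sumArrowEquivProdArrow _ _ _).symm.trans ((splitE d h).arrowCongr (Equiv.refl _))

lemma cfgE_emb {h : ℕ} {α : Type*} (R : Vtx d h → α) (L : Leaf d (h+1) → α) (v : Vtx d h) :
    cfgE d h α (R, L) (emb v) = R v := by
  have : emb v = splitE d h (Sum.inl v) := rfl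
  rw [this]
  simp [cfgE]

lemma cfgE_leaf {h : ℕ} {α : Type*} (R : Vtx d h → α) (L : Leaf d (h+1) → α) (f : Leaf d (h+1)) :
    cfgE d h α (R, L) (leafVtx f) = L f := by
  have : leafVtx f = splitE d h (Sum.inr f) := rfl
  rw [this]
  simp [cfgE]

lemma bcast_split {h : ℕ} (lam : ℝ) (x : RepSpace q k) (R : Vtx d h → RepSpace q k)
    (L : Leaf d (h+1) → RepSpace q k) :
    bcastPMF d (h+1) q k lam x (cfgE d h _ (R, L)) =
      bcastPMF d h q k lam x R *
        ∏ f : Leaf d (h+1), ker q k lam (R (leafVtx (fun i : Fin h => f i.castSucc))) (L f) := by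
  unfold bcastPMF
  rw [← (splitE d h).prod_comp, Fintype.prod_sum_type, mul_assoc]
  have hroot : root d (h+1) = emb (root d h) := rfl
  rw [hroot, cfgE_emb]
  congr 2
  · refine Finset.prod_congr rfl fun v _ => ?_
    have : splitE d h (Sum.inl v) = emb v := rfl
    rw [this, parent_emb, cfgE_emb, cfgE_emb]
    rfl
  · refine Finset.prod_congr rfl fun f _ => ?_
    have : splitE d h (Sum.inr f) = leafVtx f := rfl
    rw [this, parent_leaf, cfgE_emb, cfgE_leaf]
    rw [if_neg (show ¬ (((leafVtx f).1 : ℕ) = 0) from Nat.succ_ne_zero h)]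
    rfl

variable {A : Type*} [CommRing A] [Algebra ℝ A]

noncomputable def ZZ (d h q k : ℕ) (lam : ℝ) (x : RepSpace q k) (W : RepSpace q k → A) : A :=
  ∑ R : Vtx d h → RepSpace q k, bcastPMF d h q k lam x R • ∏ f : Leaf d h, W (R (leafVtx f))

noncomputable def GG (d q k : ℕ) (lam : ℝ) (W : RepSpace q k → A) (x : RepSpace q k) : A :=
  (∑ y, ker q k lam x y • W y) ^ d

lemma ZZ_zero (lam : ℝ) (x : RepSpace q k) (W : RepSpace q k → A) :
    ZZ d 0 q k lam x W = W x := by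
  classical
  have huniq : ∀ v : Vtx d 0, v = root d 0 := by
    rintro ⟨⟨l, hl⟩, v⟩
    obtain rfl : l = 0 := by omega
    unfold root
    congr 1
    funext i
    exact i.elim0
  let _ : Unique (Vtx d 0) := ⟨⟨root d 0⟩, huniq⟩
  unfold ZZ
  rw [← (Equiv.funUnique (Vtx d 0) (RepSpace q k)).symm.sum_comp]
  rw [Finset.sum_eq_single x]
  · have h1 : bcastPMF d 0 q k lam x ((Equiv.funUnique (Vtx d 0) (RepSpace q k)).symm x) = 1 := by
      unfold bcastPMF
      have h3 : (Equiv.funUnique (Vtx d 0) (RepSpace q k)).symm x (root d 0) = x := rfl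
      rw [if_pos h3, one_mul]
      refine Finset.prod_eq_one fun v _ => ?_
      rw [huniq v]
      exact if_pos rfl
    rw [h1, one_smul]
    have h2 : ∀ f : Leaf d 0, W ((Equiv.funUnique (Vtx d 0) (RepSpace q k)).symm x (leafVtx f)) = W x :=
      fun _ => rfl
    simp only [h2]
    simp
  · intro y _ hy
    simp [bcastPMF, hy]
  · simp

lemma prod_leaf {A : Type*} [CommRing A] {h : ℕ} (g : Leaf d h → A) :
    ∏ f : Leaf d (h+1), g (fun i : Fin h => f i.castSucc) = ∏ f : Leaf d h, g f ^ d := by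
  rw [← (Fin.snocEquiv (fun _ : Fin (h+1) => Fin d)).prod_comp, Fintype.prod_prod_type_right]
  refine Finset.prod_congr rfl fun f _ => ?_
  simp [Fin.snocEquiv]

lemma ZZ_succ {h : ℕ} (lam : ℝ) (x : RepSpace q k) (W : RepSpace q k → A) :
    ZZ d (h+1) q k lam x W = ZZ d h q k lam x (GG d q k lam W) := by
  classical
  unfold ZZ
  rw [← (cfgE d h (RepSpace q k)).sum_comp, Fintype.sum_prod_type]
  refine Finset.sum_congr rfl fun R _ => ?_
  simp only [bcast_split, cfgE_leaf, mul_smul, ← Finset.smul_sum]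
  congr 1
  unfold GG
  rw [← prod_leaf (fun f : Leaf d h => ∑ y, ker q k lam (R (leafVtx f)) y • W y)]
  rw [Finset.prod_univ_sum, Fintype.piFinset_univ]
  refine Finset.sum_congr rfl fun L _ => ?_
  simp only [Algebra.smul_def, Finset.prod_mul_distrib, map_prod]

lemma ZZ_eq {h : ℕ} (lam : ℝ) (x : RepSpace q k) (W : RepSpace q k → A) :
    ZZ d h q k lam x W = (GG d q k lam)^[h] W x := by
  induction h generalizing W with
  | zero => exact ZZ_zero lam x W
  | succ h ih => rw [ZZ_succ, ih]; rfl

end tree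

section kernel
variable {d q k : ℕ}

lemma edge_nonneg (lam : ℝ) (h0 : 0 ≤ lam) (h1 : lam ≤ 1) (a b : Fin q) :
    0 ≤ edgeFactor q lam a b := by
  unfold edgeFactor
  have : 0 ≤ (1 - lam) / q := div_nonneg (by linarith) (Nat.cast_nonneg _)
  split_ifs <;> linarith

lemma edge_ge (lam : ℝ) (h0 : 0 ≤ lam) (a b : Fin q) :
    (1 - lam) / q ≤ edgeFactor q lam a b := by
  unfold edgeFactor
  split_ifs <;> linarith

lemma edge_sum (lam : ℝ) (hq : 1 ≤ q) (b : Fin q) :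
    ∑ a, edgeFactor q lam a b = 1 := by
  unfold edgeFactor
  have : (q:ℝ) ≠ 0 := by positivity
  simp [Finset.sum_add_distrib]
  field_simp
  ring

lemma ker_sum (lam : ℝ) (hq : 1 ≤ q) (x : RepSpace q k) : ∑ y, ker q k lam x y = 1 := by
  unfold ker
  have := Finset.prod_univ_sum (fun _ : Fin k => (Finset.univ : Finset (Fin q)))
    (fun i a => edgeFactor q lam a (x i))
  rw [Fintype.piFinset_univ] at this
  rw [← this]
  exact Finset.prod_eq_one fun i _ => edge_sum lam hq (x i)

lemma ker_ge (lam : ℝ) (h0 : 0 ≤ lam) (h1 : lam ≤ 1) (x y : RepSpace q k) :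
    ((1 - lam) / q) ^ k ≤ ker q k lam x y := by
  unfold ker
  have : ∏ _i : Fin k, (1 - lam) / (q:ℝ) = ((1 - lam) / q) ^ k := by
    rw [Finset.prod_const, Finset.card_univ, Fintype.card_fin]
  rw [← this]
  exact Finset.prod_le_prod (fun _ _ => div_nonneg (by linarith) (Nat.cast_nonneg _))
    (fun i _ => edge_ge lam h0 _ _)

def swapE (i : Fin k) : RepSpace q k × Fin q ≃ RepSpace q k × Fin q where
  toFun p := (Function.update p.1 i p.2, p.1 i)
  invFun p := (Function.update p.1 i p.2, p.1 i)
  left_inv p := by simp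
  right_inv p := by simp

lemma sum_update {A : Type*} [AddCommMonoid A] (i : Fin k) (a : Fin q) (F : RepSpace q k → A) :
    ∑ z, F z = ∑ z : RepSpace q k, if z i = a then ∑ c, F (Function.update z i c) else 0 := by
  have h := (swapE (q := q) i).sum_comp
    (fun p : RepSpace q k × Fin q => if p.1 i = a then F (Function.update p.1 i p.2) else 0)
  rw [Fintype.sum_prod_type, Fintype.sum_prod_type] at h
  simp only [swapE, Equiv.coe_fn_mk, Function.update_self, Function.update_idem,
    Function.update_eq_self] at h
  simp only [Finset.sum_ite_eq', Finset.mem_univ, if_true] at h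
  rw [h]
  refine Finset.sum_congr rfl fun z _ => ?_
  split_ifs <;> simp

noncomputable def wt (lam : ℝ) (i : Fin k) (x z : RepSpace q k) : ℝ :=
  ∏ j ∈ Finset.univ.erase i, edgeFactor q lam (z j) (x j)

lemma ker_wt (lam : ℝ) (i : Fin k) (x z : RepSpace q k) :
    ker q k lam x z = edgeFactor q lam (z i) (x i) * wt lam i x z := by
  unfold ker wt
  rw [Finset.mul_prod_erase _ (fun j => edgeFactor q lam (z j) (x j)) (Finset.mem_univ i)]

lemma wt_update_right (lam : ℝ) (i : Fin k) (x z : RepSpace q k) (c : Fin q) :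
    wt lam i x (Function.update z i c) = wt lam i x z := by
  unfold wt
  refine Finset.prod_congr rfl fun j hj => ?_
  rw [Function.update_of_ne (Finset.ne_of_mem_erase hj)]

lemma wt_update_left (lam : ℝ) (i : Fin k) (x z : RepSpace q k) (c : Fin q) :
    wt lam i (Function.update x i c) z = wt lam i x z := by
  unfold wt
  refine Finset.prod_congr rfl fun j hj => ?_
  rw [Function.update_of_ne (Finset.ne_of_mem_erase hj)]

lemma ker_shift {A : Type*} [AddCommGroup A] [Module ℝ A] (lam : ℝ) (hq : 1 ≤ q) (i : Fin k)
    (x : RepSpace q k) (a : Fin q) (W : RepSpace q k → A) :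
    ∑ z, ker q k lam x z • W (Function.update z i a)
      = ∑ z : RepSpace q k, if z i = a then wt lam i x z • W z else 0 := by
  rw [sum_update i a]
  refine Finset.sum_congr rfl fun z _ => ?_
  split_ifs with hz
  · have : ∀ c, ker q k lam x (Function.update z i c) • W (Function.update (Function.update z i c) i a)
        = edgeFactor q lam c (x i) • (wt lam i x z • W z) := by
      intro c
      rw [ker_wt lam i, wt_update_right, Function.update_self, Function.update_idem, mul_smul]
      rw [← hz, Function.update_eq_self]
    simp only [this]
    rw [← Finset.sum_smul, edge_sum lam hq, one_smul]
  · rfl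

lemma ker_diff {A : Type*} [AddCommGroup A] [Module ℝ A] (lam : ℝ) (hq : 1 ≤ q) (i : Fin k)
    (x : RepSpace q k) (b : Fin q) (W : RepSpace q k → A) :
    ∑ z, ker q k lam x z • W z - ∑ z, ker q k lam (Function.update x i b) z • W z
     = lam • ∑ z, ker q k lam x z • (W (Function.update z i (x i)) - W (Function.update z i b)) := by
  simp only [smul_sub, Finset.sum_sub_distrib, ker_shift lam hq]
  rw [Finset.smul_sum, Finset.smul_sum, ← Finset.sum_sub_distrib, ← Finset.sum_sub_distrib]
  refine Finset.sum_congr rfl fun z _ => ?_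
  rw [ker_wt lam i x, ker_wt lam i (Function.update x i b), wt_update_left, Function.update_self]
  unfold edgeFactor
  split_ifs <;> module

/-- final distance bound -/
lemma dist_one (hd : 1 ≤ d) (hq : 1 ≤ q) (lam : ℝ) (h0 : 0 ≤ lam) (h1 : lam < 1)
    (h : ℕ) (x : RepSpace q k) (i : Fin k) (b : Fin q) :
    nrm (ZZ d h q k lam x X - ZZ d h q k lam (Function.update x i b) X)
      ≤ (2 / √(((1 - lam) / q) ^ k / 2)) * (√d * lam) ^ h := by
  rw [ZZ_eq, ZZ_eq]
  have hq0 : (0:ℝ) < q := by exact_mod_cast hq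
  have hq1 : (1:ℝ) ≤ q := by exact_mod_cast hq
  refine contract' (ker q k lam) d hd lam (((1 - lam) / q) ^ k) h0
    (pow_pos (div_pos (by linarith) hq0) k)
    (pow_le_one₀ (div_nonneg (by linarith) hq0.le) (by rw [div_le_one hq0]; linarith))
    (ker_ge lam h0 h1.le) (ker_sum lam hq)
    (fun x y => ∃ i b, y = Function.update x i b) ?_ h x _ ⟨i, b, rfl⟩
  rintro x y ⟨i, b, rfl⟩
  refine ⟨fun z => Function.update z i (x i), fun z => Function.update z i b, ?_, ?_⟩
  · intro z
    exact ⟨i, b, by simp⟩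
  · intro W
    exact ker_diff lam hq i x b W

lemma dist_all (hd : 1 ≤ d) (hq : 1 ≤ q) (lam : ℝ) (h0 : 0 ≤ lam) (h1 : lam < 1)
    (h : ℕ) (x y : RepSpace q k) :
    nrm (ZZ d h q k lam x X - ZZ d h q k lam y X)
      ≤ k * ((2 / √(((1 - lam) / q) ^ k / 2)) * (√d * lam) ^ h) := by
  classical
  set B := (2 / √(((1 - lam) / q) ^ k / 2)) * (√d * lam) ^ h with hB
  have key : ∀ S : Finset (Fin k),
      nrm (ZZ d h q k lam x X - ZZ d h q k lam (fun j => if j ∈ S then y j else x j) X)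
        ≤ S.card * B := by
    intro S
    induction S using Finset.induction_on with
    | empty => simp [nrm_zero]
    | insert i S hi ih =>
      have e : (fun j => if j ∈ insert i S then y j else x j)
          = Function.update (fun j => if j ∈ S then y j else x j) i (y i) := by
        funext j
        by_cases hj : j = i
        · subst hj; simp
        · simp [hj]
      rw [e, Finset.card_insert_of_notMem hi]
      have h2 := dist_one hd hq lam h0 h1 h (fun j => if j ∈ S then y j else x j) i (y i)
      have h3 := nrm_add (ZZ d h q k lam x X - ZZ d h q k lam (fun j => if j ∈ S then y j else x j) X)
        (ZZ d h q k lam (fun j => if j ∈ S then y j else x j) X -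
          ZZ d h q k lam (Function.update (fun j => if j ∈ S then y j else x j) i (y i)) X)
      rw [sub_add_sub_cancel] at h3
      push_cast
      linarith
  have := key Finset.univ
  simpa using this

lemma bcast_nonneg (h : ℕ) (lam : ℝ) (h0 : 0 ≤ lam) (h1 : lam ≤ 1) (x : RepSpace q k)
    (R : Vtx d h → RepSpace q k) : 0 ≤ bcastPMF d h q k lam x R := by
  unfold bcastPMF
  refine mul_nonneg (by split_ifs <;> norm_num) (Finset.prod_nonneg fun v _ => ?_)
  split_ifs
  · norm_num
  · exact Finset.prod_nonneg fun i _ => edge_nonneg lam h0 h1 _ _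

lemma bcast_sum (h : ℕ) (lam : ℝ) (hq : 1 ≤ q) (x : RepSpace q k) :
    ∑ R : Vtx d h → RepSpace q k, bcastPMF d h q k lam x R = 1 := by
  have h1 : ZZ d h q k lam x (fun _ => (1:ℝ)) = ∑ R, bcastPMF d h q k lam x R := by
    simp [ZZ]
  rw [← h1, ZZ_eq]
  have h2 : GG d q k lam (fun _ => (1:ℝ)) = fun _ => (1:ℝ) := by
    funext z
    simp [GG, ker_sum lam hq]
  rw [Function.iterate_fixed h2]

lemma countDist_nonneg (h : ℕ) (lam : ℝ) (h0 : 0 ≤ lam) (h1 : lam ≤ 1) (x : RepSpace q k)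
    (s : RepSpace q k → ℕ) : 0 ≤ countDist d h q k lam x s :=
  Finset.sum_nonneg fun _ _ => bcast_nonneg h lam h0 h1 x _

open Classical in
lemma coeff_ZZ (h : ℕ) (lam : ℝ) (x : RepSpace q k) (s : RepSpace q k → ℕ) :
    coeff (Finsupp.equivFunOnFinite.symm s) (ZZ d h q k lam x X) = countDist d h q k lam x s := by
  unfold ZZ countDist
  rw [coeff_sum, Finset.sum_filter]
  refine Finset.sum_congr rfl fun R _ => ?_
  have h1 : ∏ f : Leaf d h, (X (R (leafVtx f)) : MvPolynomial (RepSpace q k) ℝ)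
      = monomial (Finsupp.equivFunOnFinite.symm (countStat d h q k R)) 1 := by
    have : Finsupp.equivFunOnFinite.symm (countStat d h q k R)
        = ∑ f : Leaf d h, Finsupp.single (R (leafVtx f)) 1 := by
      ext y
      simp [countStat, Finsupp.finsetSum_apply, Finsupp.single_apply]
    rw [this, monomial_sum_one]
    rfl
  rw [h1, coeff_smul, coeff_monomial]
  simp only [Equiv.apply_eq_iff_eq]
  split_ifs <;> simp

end kernel

end CR

/-- Count reconstruction lemma: if `d·λ² < 1` then there are constants `c, C > 0`
(depending only on `d, q, k, λ` but not on `h`) such that for every depth `h` there is a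
probability mass function `Q_h` on count vectors with
`P_{x,h}(s) ≥ (1 − C·exp(−c·h))·Q_h(s)` for every root value `x` and every count vector
`s`; equivalently, `P_{x,h} = (1−η)·Q_h + η·P'_{x,h}` with `η ≤ C·exp(−c·h)`. -/
theorem count_reconstruction_coupling (d q k : ℕ) (lam : ℝ)
    (hd : 2 ≤ d) (hq : 2 ≤ q) (hk : 1 ≤ k)
    (hlam0 : 0 ≤ lam) (hlam1 : lam ≤ 1)
    (hKS : (d : ℝ) * lam ^ 2 < 1) :
    ∃ c : ℝ, 0 < c ∧ ∃ C : ℝ, 0 < C ∧ ∀ h : ℕ, 1 ≤ h →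
      ∃ Q : (RepSpace q k → ℕ) → ℝ,
        (∀ s, 0 ≤ Q s) ∧ (∑' s : RepSpace q k → ℕ, Q s = 1) ∧
        ∀ (x : RepSpace q k) (s : RepSpace q k → ℕ),
          (1 - C * Real.exp (-c * h)) * Q s ≤ countDist d h q k lam x s := by
  classical
  have hq1 : 1 ≤ q := by omega
  have hd1 : 1 ≤ d := by omega
  have hd2 : (2:ℝ) ≤ d := by exact_mod_cast hd
  have hlt : lam < 1 := by
    by_contra hcon
    have : lam = 1 := le_antisymm hlam1 (not_lt.mp hcon)
    rw [this] at hKS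
    linarith
  have hqpos : (0:ℝ) < q := by exact_mod_cast hq1
  have hr0 : 0 ≤ √(d:ℝ) * lam := by positivity
  have hr1 : √(d:ℝ) * lam < 1 := by
    refine lt_of_pow_lt_pow_left₀ 2 zero_le_one ?_
    rw [mul_pow, Real.sq_sqrt (by positivity), one_pow]
    exact hKS
  set r : ℝ := max (√(d:ℝ) * lam) (1/2) with hr
  have hrpos : 0 < r := lt_of_lt_of_le (by norm_num) (le_max_right _ _)
  have hrlt : r < 1 := max_lt hr1 (by norm_num)
  set e : ℝ := ((1 - lam) / q) ^ k with he
  have hepos : 0 < e := pow_pos (div_pos (by linarith) hqpos) k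
  set K : ℝ := (Fintype.card (RepSpace q k) : ℝ) with hK
  set C0 : ℝ := K * (k * (2 / √(e / 2))) with hC0
  have hC0nn : 0 ≤ C0 := by positivity
  refine ⟨-Real.log r, by linarith [Real.log_neg hrpos hrlt], C0 + 1, by linarith, ?_⟩
  intro h _
  have hexp : Real.exp (-(-Real.log r) * h) = r ^ h := by
    rw [neg_neg, mul_comm, Real.exp_nat_mul, Real.exp_log hrpos]
  rw [hexp]
  let x0 : RepSpace q k := fun _ => ⟨0, by omega⟩
  let P : RepSpace q k → (RepSpace q k → ℕ) → ℝ := fun x s => countDist d h q k lam x s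
  have hPnn : ∀ x s, 0 ≤ P x s := fun x s => CR.countDist_nonneg h lam hlam0 hlam1 x s
  let S0 : Finset (RepSpace q k → ℕ) := Finset.univ.image (countStat d h q k)
  have hPoff : ∀ x s, s ∉ S0 → P x s = 0 := by
    intro x s hs
    show countDist d h q k lam x s = 0
    unfold countDist
    rw [Finset.filter_eq_empty_iff.mpr, Finset.sum_empty]
    intro R _ hR
    exact hs (Finset.mem_image.mpr ⟨R, Finset.mem_univ _, hR⟩)
  have hPsum : ∀ x, ∑ s ∈ S0, P x s = 1 := by
    intro x
    rw [← CR.bcast_sum (d := d) h lam hq1 x]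
    exact Finset.sum_fiberwise_of_maps_to
      (fun R _ => Finset.mem_image_of_mem _ (Finset.mem_univ R)) _
  have hdist : ∀ x, ∑ s ∈ S0, |P x0 s - P x s| ≤ (k * (2 / √(e / 2))) * r ^ h := by
    intro x
    have h1 := CR.dist_all (d := d) hd1 hq1 lam hlam0 hlt h x0 x
    have h2 := CR.le_nrm (CR.ZZ d h q k lam x0 MvPolynomial.X - CR.ZZ d h q k lam x MvPolynomial.X)
      (S0.map Finsupp.equivFunOnFinite.symm.toEmbedding)
    rw [Finset.sum_map] at h2
    simp only [MvPolynomial.coeff_sub, Equiv.coe_toEmbedding, CR.coeff_ZZ] at h2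
    refine h2.trans (h1.trans ?_)
    rw [mul_assoc]
    gcongr
    exact le_max_left _ _
  by_cases hneg : 1 - (C0 + 1) * r ^ h ≤ 0
  · refine ⟨P x0, hPnn x0, ?_, ?_⟩
    · rw [tsum_eq_sum (fun s hs => hPoff x0 s hs)]
      exact hPsum x0
    · intro x s
      exact (mul_nonpos_of_nonpos_of_nonneg hneg (hPnn x0 s)).trans (hPnn x s)
  · rw [not_le] at hneg
    have hne : (Finset.univ : Finset (RepSpace q k)).Nonempty := ⟨x0, Finset.mem_univ _⟩
    let m : (RepSpace q k → ℕ) → ℝ := fun s => Finset.univ.inf' hne (fun x => P x s)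
    have hmle : ∀ x s, m s ≤ P x s := fun x s => Finset.inf'_le _ (Finset.mem_univ x)
    have hmnn : ∀ s, 0 ≤ m s := fun s => Finset.le_inf' _ _ (fun x _ => hPnn x s)
    have hmge : ∀ s, P x0 s - ∑ x, |P x0 s - P x s| ≤ m s := by
      intro s
      refine Finset.le_inf' _ _ (fun x _ => ?_)
      have h1 : |P x0 s - P x s| ≤ ∑ x, |P x0 s - P x s| :=
        Finset.single_le_sum (f := fun x => |P x0 s - P x s|)
          (fun _ _ => abs_nonneg _) (Finset.mem_univ x)
      have h2 := le_abs_self (P x0 s - P x s)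
      linarith
    set T : ℝ := ∑ s ∈ S0, m s with hT
    have hTge : 1 - (C0 + 1) * r ^ h ≤ T := by
      have h1 : ∑ s ∈ S0, (P x0 s - ∑ x, |P x0 s - P x s|) ≤ T :=
        Finset.sum_le_sum fun s _ => hmge s
      rw [Finset.sum_sub_distrib, hPsum, Finset.sum_comm] at h1
      have h2 : ∑ x : RepSpace q k, ∑ s ∈ S0, |P x0 s - P x s| ≤ C0 * r ^ h := by
        refine (Finset.sum_le_sum fun x _ => hdist x).trans (le_of_eq ?_)
        rw [Finset.sum_const, Finset.card_univ, nsmul_eq_mul, hC0]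
        ring
      have h3 : 0 ≤ r ^ h := by positivity
      linarith
    have hTpos : 0 < T := lt_of_lt_of_le hneg hTge
    refine ⟨fun s => m s / T, fun s => div_nonneg (hmnn s) hTpos.le, ?_, ?_⟩
    · rw [tsum_eq_sum (s := S0), ← Finset.sum_div, div_self hTpos.ne']
      intro s hs
      have : m s = 0 := le_antisymm ((hmle x0 s).trans (hPoff x0 s hs).le) (hmnn s)
      rw [this, zero_div]
    · intro x s
      calc _ ≤ T * (m s / T) := mul_le_mul_of_nonneg_right hTge (div_nonneg (hmnn s) hTpos.le)
        _ = m s := by field_simp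
        _ ≤ _ := hmle x s
end

section
/- Let M ≥ 1, q ≥ 2, k ≥ 1 and λ' ∈ [0,1). Let I be uniformly distributed on {1,…,M}, let (X_1,…,X_M) be ((Fin q)^k)-valued random variables with arbitrary joint distribution, independent of I, and conditionally on (I, X_1,…,X_M) let W ∈ (Fin q)^k be generated from X_I through the k-fold product q-ary symmetric channel with retention parameter λ'. Then for every function g : (Fin q)^k × ((Fin q)^k)^M → {1,…,M}, the probability that g(W, X_1,…,X_M) = I is at most (1/M)·(1 + q·λ'/(1 − λ'))^k. (Core posterior bound underlying the lower bound for local algorithms.) -/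
/-- The likelihood assigned by the `k`-fold product `q`-ary symmetric channel with
retention parameter `λ'` to output `w` given input `x`. -/
noncomputable def chanLik (q k : ℕ) (lam : ℝ) (x w : Fin k → Fin q) : ℝ :=
  ∏ i : Fin k, (lam * (if w i = x i then 1 else 0) + (1 - lam) / q)

open Finset in
/-- Posterior bound underlying the lower bound for local algorithms: let `I` be uniform on
`{1,…,M}`, let `(X₁,…,X_M)` have an arbitrary joint distribution `μ` independent of `I`,
and let `W` be obtained from `X_I` through the `k`-fold product `q`-ary symmetric channel
with retention parameter `λ'`. Then any decoder `g(W, X₁,…,X_M)` guesses `I` correctly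
with probability at most `(1/M)·(1 + qλ'/(1−λ'))^k`. -/
theorem local_posterior_bound (M q k : ℕ) (hM : 1 ≤ M) (hq : 2 ≤ q) (hk : 1 ≤ k)
    (lam : ℝ) (hlam0 : 0 ≤ lam) (hlam1 : lam < 1)
    (μ : (Fin M → Fin k → Fin q) → ℝ) (hμ0 : ∀ x, 0 ≤ μ x) (hμ1 : ∑ x, μ x = 1)
    (g : (Fin k → Fin q) × (Fin M → Fin k → Fin q) → Fin M) :
    ∑ x : Fin M → Fin k → Fin q, ∑ i : Fin M, ∑ w : Fin k → Fin q,
        μ x * (1 / (M : ℝ)) * chanLik q k lam (x i) w *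
          (if g (w, x) = i then 1 else 0) ≤
      (1 / (M : ℝ)) * (1 + q * lam / (1 - lam)) ^ k := by
  have hq0 : (0 : ℝ) < q := by
    have : 0 < q := by omega
    exact_mod_cast this
  have hl : 0 < 1 - lam := by linarith
  have hlik : ∀ x w : Fin k → Fin q, chanLik q k lam x w ≤ (lam + (1 - lam) / q) ^ k := by
    intro x w
    unfold chanLik
    calc _ ≤ ∏ _i : Fin k, (lam + (1 - lam) / q) := by
          apply Finset.prod_le_prod
          · intro i _
            split_ifs <;> positivity
          · intro i _
            split_ifs <;> linarith
      _ = _ := by simp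
  have hC : (q : ℝ) ^ k * (lam + (1 - lam) / q) ^ k ≤ (1 + q * lam / (1 - lam)) ^ k := by
    rw [← mul_pow]
    apply pow_le_pow_left₀ (by positivity)
    have h1 : (q : ℝ) * (lam + (1 - lam) / q) = q * lam + (1 - lam) := by field_simp
    have h2 : q * lam ≤ q * lam / (1 - lam) := by
      rw [le_div_iff₀ hl]
      nlinarith [mul_nonneg hq0.le hlam0]
    rw [h1]
    linarith
  have hx : ∀ x : Fin M → Fin k → Fin q, ∑ i : Fin M, ∑ w : Fin k → Fin q,
        μ x * (1 / (M : ℝ)) * chanLik q k lam (x i) w *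
          (if g (w, x) = i then 1 else 0) ≤
        μ x * ((1 / (M : ℝ)) * (1 + q * lam / (1 - lam)) ^ k) := by
    intro x
    have hc : 0 ≤ μ x * (1 / (M : ℝ)) := mul_nonneg (hμ0 x) (by positivity)
    rw [Finset.sum_comm]
    calc _ = ∑ w : Fin k → Fin q, μ x * (1 / (M : ℝ)) * chanLik q k lam (x (g (w, x))) w := by
          simp
      _ ≤ ∑ _w : Fin k → Fin q, μ x * (1 / (M : ℝ)) * (lam + (1 - lam) / q) ^ k :=
          Finset.sum_le_sum fun w _ => mul_le_mul_of_nonneg_left (hlik _ _) hc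
      _ = μ x * (1 / (M : ℝ)) * ((q : ℝ) ^ k * (lam + (1 - lam) / q) ^ k) := by
          simp only [Finset.sum_const, Finset.card_univ, Fintype.card_fun, Fintype.card_fin,
            nsmul_eq_mul, Nat.cast_pow]
          ring
      _ ≤ μ x * (1 / (M : ℝ)) * (1 + q * lam / (1 - lam)) ^ k :=
          mul_le_mul_of_nonneg_left hC hc
      _ = _ := by ring
  calc _ ≤ ∑ x, μ x * ((1 / (M : ℝ)) * (1 + q * lam / (1 - lam)) ^ k) :=
        Finset.sum_le_sum fun x _ => hx x
    _ = _ := by rw [← Finset.sum_mul, hμ1, one_mul]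
end
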